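/- Let C be a real m×n matrix, L and N real n×m matrices, θ a symmetric positive semidefinite real m×m matrix, P a symmetric positive definite real n×n matrix with P*N*C + Cᵀ*Nᵀ*P negative definite, and let (A_i)_{i ∈ ι} be a family of real n×n matrices indexed by the uncertainty parameter such that for every i, (A_i − L*C)ᵀP + P*(A_i − L*C) is negative definite (quadratic stabilizability (21)). Then for every i and every solution e : ℝ → (Fin n → ℝ) of the uncertain cubic observer error dynamics e' = (A_i − L*C) *ᵥ e + (e ⬝ᵥ ((Cᵀ*θ*C) *ᵥ e)) • ((N*C) *ᵥ e), the Lyapunov function V(t) = e(t) ⬝ᵥ (P *ᵥ e(t)) has strictly negative derivative at every time t₀ with e(t₀) ≠ 0. (Theorem 4: robust stability of the cubic observer under quadratic stabilizability.) -/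

import Mathlib

open Matrix

theorem HasDerivAt.dotProduct_mulVec_self {n : Type*} [Fintype n] (P : Matrix n n ℝ)
    {e : ℝ → n → ℝ} {e' : n → ℝ} {t : ℝ} (h : HasDerivAt e e' t) :
    HasDerivAt (fun s => e s ⬝ᵥ (P *ᵥ e s)) (e' ⬝ᵥ (P *ᵥ e t) + e t ⬝ᵥ (P *ᵥ e')) t := by
  have hi := hasDerivAt_pi.1 h
  have hP : ∀ i, HasDerivAt (fun s => (P *ᵥ e s) i) ((P *ᵥ e') i) t := fun i => by
    simp only [mulVec, dotProduct]
    exact HasDerivAt.fun_sum fun j _ => (hi j).const_mul (P i j)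
  simp only [dotProduct, ← Finset.sum_add_distrib]
  exact HasDerivAt.fun_sum fun i _ => (hi i).fun_mul (hP i)

theorem Matrix.mulVec_dotProduct_add_dotProduct_mulVec {n R : Type*} [Fintype n] [CommRing R]
    (M P : Matrix n n R) (v : n → R) :
    (M *ᵥ v) ⬝ᵥ (P *ᵥ v) + v ⬝ᵥ (P *ᵥ (M *ᵥ v)) = v ⬝ᵥ ((Mᵀ * P + P * M) *ᵥ v) := by
  rw [add_mulVec, dotProduct_add, ← mulVec_mulVec, ← mulVec_mulVec, dotProduct_mulVec v Mᵀ,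
    vecMul_transpose]

/-- Theorem 4: under quadratic stabilizability (21) and condition (13), the cubic
observer error dynamics are robustly stable: for every uncertainty parameter the
Lyapunov function decreases strictly along nonzero errors. -/
theorem cubic_observer_thm4_robust {n m : ℕ} {ι : Type*}
    (Afam : ι → Matrix (Fin n) (Fin n) ℝ) (C : Matrix (Fin m) (Fin n) ℝ)
    (L N : Matrix (Fin n) (Fin m) ℝ) (θ : Matrix (Fin m) (Fin m) ℝ)
    (P : Matrix (Fin n) (Fin n) ℝ)
    (hθsymm : θᵀ = θ)
    (hθpsd : ∀ w : Fin m → ℝ, 0 ≤ w ⬝ᵥ (θ *ᵥ w))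
    (hPsymm : Pᵀ = P)
    (hPpos : ∀ v : Fin n → ℝ, v ≠ 0 → 0 < v ⬝ᵥ (P *ᵥ v))
    (hNnd : ∀ v : Fin n → ℝ, v ≠ 0 →
      v ⬝ᵥ ((P * N * C + Cᵀ * Nᵀ * P) *ᵥ v) < 0)
    (hLyap : ∀ i : ι, ∀ v : Fin n → ℝ, v ≠ 0 →
      v ⬝ᵥ (((Afam i - L * C)ᵀ * P + P * (Afam i - L * C)) *ᵥ v) < 0) :
    ∀ i : ι, ∀ e : ℝ → (Fin n → ℝ),
      (∀ t : ℝ, HasDerivAt e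
        ((Afam i - L * C) *ᵥ (e t) +
          ((e t) ⬝ᵥ ((Cᵀ * θ * C) *ᵥ (e t))) • ((N * C) *ᵥ (e t))) t) →
      ∀ t₀ : ℝ, e t₀ ≠ 0 →
        deriv (fun t => (e t) ⬝ᵥ (P *ᵥ (e t))) t₀ < 0 := by
  intro i e he t₀ h0
  rw [(he t₀).dotProduct_mulVec_self P |>.deriv]
  set v := e t₀
  have hq : 0 ≤ v ⬝ᵥ ((Cᵀ * θ * C) *ᵥ v) := by
    rw [← mulVec_mulVec, ← mulVec_mulVec, dotProduct_mulVec, vecMul_transpose]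
    exact hθpsd _
  have hA := hLyap i v h0
  have hN := hNnd v h0
  rw [← mulVec_dotProduct_add_dotProduct_mulVec] at hA
  rw [add_comm (P * N * C), Matrix.mul_assoc P, ← transpose_mul,
    ← mulVec_dotProduct_add_dotProduct_mulVec] at hN
  simp only [add_dotProduct, smul_dotProduct, mulVec_add, mulVec_smul, dotProduct_add,
    dotProduct_smul, smul_eq_mul]
  linarith [mul_nonpos_of_nonneg_of_nonpos hq hN.le]
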